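/- arXiv:math/0511698 — 2 statements merged into one kernel-verified Lean document; each statement's English description precedes it below -/
import Mathlib

section
/- For any σ ∈ S_n, τ ∈ S_m and 1 ≤ i ≤ n, the tree associated to the inserted permutation equals the insertion of the associated trees: λ(B_i(σ,τ)) = B_i(λ(σ), λ(τ)), where on the right B_i denotes the insertion operation on planar binary trees. -/
open Equiv

/-- The one-line value (0-indexed) of a permutation of `Fin N`, extended to all of `ℕ`
by the identity.  Position `j` (0-indexed) carries the value `pv σ j` (0-indexed). -/
def pv {N : ℕ} (σ : Equiv.Perm (Fin N)) (j : ℕ) : ℕ :=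
  if h : j < N then (σ ⟨j, h⟩ : ℕ) else j

/-- The left weak (Bruhat) order on `S_N`: inclusion of inversion sets, where the
inversion set of `σ` is `{(p,q) | p < q ∧ σ p > σ q}`. -/
def wle {N : ℕ} (σ τ : Equiv.Perm (Fin N)) : Prop :=
  ∀ p q : Fin N, p < q → σ q < σ p → τ q < τ p

instance {N : ℕ} (σ τ : Equiv.Perm (Fin N)) : Decidable (wle σ τ) :=
  inferInstanceAs (Decidable (∀ p q : Fin N, p < q → σ q < σ p → τ q < τ p))

/-- The `a`-values of the insertion construction `B_i` (0-indexed values):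
`avv m s x = x` if `x < s` and `x + m - 1` otherwise. -/
def avv (m s x : ℕ) : ℕ := if x < s then x else x + m - 1

/-- The one-line values of the permutation `B_i(σ,τ) ∈ S_{n+m-1}`
(0-indexed position `i`, with `i < n`, and 0-indexed values). -/
def BFun {n m : ℕ} (i : ℕ) (σ : Equiv.Perm (Fin n)) (τ : Equiv.Perm (Fin m)) (j : ℕ) : ℕ :=
  if j < i then avv m (pv σ i) (pv σ j)
  else if j < i + m then pv τ (j - i) + pv σ i
  else avv m (pv σ i) (pv σ (j - m + 1))

/-- `ρ ∈ S_{n+m-1}` is the permutation `B_i(σ,τ)`. -/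
def IsB {n m : ℕ} (i : ℕ) (σ : Equiv.Perm (Fin n)) (τ : Equiv.Perm (Fin m))
    (ρ : Equiv.Perm (Fin (n + m - 1))) : Prop :=
  ∀ j : ℕ, j < n + m - 1 → pv ρ j = BFun i σ τ j

/-- Rooted planar binary trees: `leaf` is the tree `1₀` with one leaf and no internal
node, and `node l r = l ∨ r` is the grafting of `l` and `r`. -/
inductive PBT : Type
  | leaf : PBT
  | node : PBT → PBT → PBT
  deriving DecidableEq

/-- The number of internal nodes of a tree (`t ∈ Y_n` iff `t.size = n`). -/
def PBT.size : PBT → ℕ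
  | .leaf => 0
  | .node l r => l.size + r.size + 1

/-- `s \ t`: glue the root of `t` onto the rightmost branch of `s`. -/
def PBT.under : PBT → PBT → PBT
  | .leaf, t => t
  | .node l r, t => .node l (PBT.under r t)

/-- `s / t`: glue the root of `s` onto the leftmost branch of `t`. -/
def PBT.over : PBT → PBT → PBT
  | s, .leaf => s
  | s, .node l r => .node (PBT.over s l) r

/-- The insertion operation `B_i(s,t)` on trees, `i` being 1-indexed (`1 ≤ i ≤ size s`).
Writing `s = s_l ∨ s_r` and `j = |s_l| + 1`:
`B_i(s,t) = B_i(s_l,t) ∨ s_r` if `i < j`, `(s_l/t_l) ∨ (t_r\s_r)` if `i = j` (where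
`t = t_l ∨ t_r`), and `s_l ∨ B_{i-j}(s_r,t)` if `i > j`. -/
def PBT.binsert : PBT → ℕ → PBT → PBT
  | .leaf, _, t => t
  | .node sl sr, i, t =>
    if i < sl.size + 1 then .node (PBT.binsert sl i t) sr
    else if i = sl.size + 1 then
      match t with
      | .leaf => .node sl sr
      | .node tl tr => .node (PBT.over sl tl) (PBT.under tr sr)
    else .node sl (PBT.binsert sr (i - (sl.size + 1)) t)

/-- `IsLam σ t` holds iff `λ(σ) = t`, where `λ : S_n → Y_n` is defined recursively by
`λ(∅) = 1₀` and `λ(σ) = λ(st(σ_1,…,σ_{j-1})) ∨ λ(st(σ_{j+1},…,σ_n))` with `j = σ⁻¹(n)`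
(0-indexed below: `pv σ j = n - 1`). -/
inductive IsLam : {n : ℕ} → Equiv.Perm (Fin n) → PBT → Prop
  | base (σ : Equiv.Perm (Fin 0)) : IsLam σ PBT.leaf
  | node {n : ℕ} (σ : Equiv.Perm (Fin n)) (j : ℕ) (hj : j < n) (hmax : pv σ j = n - 1)
      {σl : Equiv.Perm (Fin j)} {σr : Equiv.Perm (Fin (n - 1 - j))} {tl tr : PBT}
      (hl : ∀ p q : Fin j, σl p < σl q ↔ pv σ p < pv σ q)
      (hr : ∀ p q : Fin (n - 1 - j), σr p < σr q ↔ pv σ (j + 1 + p) < pv σ (j + 1 + q))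
      (htl : IsLam σl tl) (htr : IsLam σr tr) : IsLam σ (PBT.node tl tr)

/-- `IsDecTree f n t` says that `t` is the decreasing binary tree of the word
`f 0, …, f (n - 1)`. -/
def IsDecTree : (ℕ → ℕ) → ℕ → PBT → Prop
  | _, n, .leaf => n = 0
  | f, n, .node l r => ∃ j < n, (∀ k < n, k ≠ j → f k < f j) ∧ IsDecTree f j l ∧
      IsDecTree (fun x => f (j + 1 + x)) (n - 1 - j) r

namespace IsDecTree

theorem of_lt_imp_lt {t : PBT} : ∀ {f g : ℕ → ℕ} {n : ℕ}, IsDecTree f n t →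
    (∀ p < n, ∀ q < n, f p < f q → g p < g q) → IsDecTree g n t := by
  induction t with
  | leaf => intro f g n h _; exact h
  | node l r ihl ihr =>
    rintro f g n ⟨j, hj, hmax, hl, hr⟩ H
    exact ⟨j, hj, fun k hk hkj => H k hk j hj (hmax k hk hkj),
      ihl hl fun p hp q hq => H p (by omega) q (by omega),
      ihr hr fun p hp q hq => H _ (by omega) _ (by omega)⟩

theorem unique {t : PBT} : ∀ {u : PBT} {f : ℕ → ℕ} {n : ℕ}, IsDecTree f n t →
    IsDecTree f n u → t = u := by
  induction t with
  | leaf =>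
    rintro (_ | ⟨l, r⟩) f n h h'
    · rfl
    · obtain ⟨j, hj, -⟩ := h'
      simp only [IsDecTree] at h
      omega
  | node l r ihl ihr =>
    rintro (_ | ⟨l', r'⟩) f n ⟨j, hj, hmax, hl, hr⟩ h'
    · simp only [IsDecTree] at h'
      omega
    · obtain ⟨k, hk, hmax', hl', hr'⟩ := h'
      obtain rfl : j = k := by
        by_contra hjk
        have h₁ := hmax k hk (Ne.symm hjk)
        have h₂ := hmax' j hj hjk
        omega
      rw [ihl hl hl', ihr hr hr']

theorem size_eq {t : PBT} : ∀ {f : ℕ → ℕ} {n : ℕ}, IsDecTree f n t → t.size = n := by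
  induction t with
  | leaf => intro f n h; exact h.symm
  | node l r ihl ihr =>
    rintro f n ⟨j, hj, -, hl, hr⟩
    have h₁ := ihl hl
    have h₂ := ihr hr
    simp only [PBT.size]
    omega

theorem over_of_forall_lt {s t : PBT} {f : ℕ → ℕ} {a : ℕ} (hs : IsDecTree f a s) : ∀ {b : ℕ},
    IsDecTree (fun x => f (a + x)) b t → (∀ p < a, ∀ q < b, f p < f (a + q)) →
    IsDecTree f (a + b) (PBT.over s t) := by
  induction t with
  | leaf =>
    rintro b rfl _
    simpa [PBT.over] using hs
  | node l r ihl ihr =>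
    rintro b ⟨j, hj, hmax, hl, hr⟩ H
    refine ⟨a + j, by omega, fun k hk hkj => ?_, ihl hl fun p hp q hq => H p hp q (by omega), ?_⟩
    · by_cases hka : k < a
      · exact H k hka j hj
      · have : f (a + (k - a)) < f (a + j) := hmax (k - a) (by omega) (by omega)
        rwa [show a + (k - a) = k by omega] at this
    · rw [show a + b - 1 - (a + j) = b - 1 - j by omega]
      simpa only [← add_assoc] using hr

theorem under_of_forall_lt {s t : PBT} : ∀ {f : ℕ → ℕ} {a b : ℕ}, IsDecTree f a s →
    IsDecTree (fun x => f (a + x)) b t → (∀ p < a, ∀ q < b, f (a + q) < f p) →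
    IsDecTree f (a + b) (PBT.under s t) := by
  induction s with
  | leaf =>
    rintro f a b rfl ht _
    simpa [PBT.under] using ht
  | node l r ihl ihr =>
    rintro f a b ⟨j, hj, hmax, hl, hr⟩ ht H
    refine ⟨j, by omega, fun k hk hkj => ?_, hl, ?_⟩
    · by_cases hka : k < a
      · exact hmax k hka hkj
      · have := H j hj (k - a) (by omega)
        rwa [show a + (k - a) = k by omega] at this
    · rw [show a + b - 1 - j = (a - 1 - j) + b by omega]
      refine ihr hr ?_ fun p hp q hq => ?_
      · refine ht.of_lt_imp_lt fun p _ q _ hpq => ?_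
        rwa [show j + 1 + (a - 1 - j + p) = a + p by omega,
          show j + 1 + (a - 1 - j + q) = a + q by omega]
      · have := H (j + 1 + p) (by omega) q hq
        rwa [show j + 1 + (a - 1 - j + q) = a + q by omega]

end IsDecTree

/-- The position in a word of the letter at position `p ≠ i` after the letter at position `i`
is replaced by `m` letters. -/
def shiftPos (i m p : ℕ) : ℕ := if p < i then p else p + m - 1

theorem shiftPos_of_lt {i m p : ℕ} (h : p < i) : shiftPos i m p = p := if_pos h

theorem shiftPos_of_gt {i m p : ℕ} (h : i < p) : shiftPos i m p = p + m - 1 :=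
  if_neg (by omega)

theorem shiftPos_add (c i m p : ℕ) (hm : 1 ≤ m) :
    shiftPos (c + i) m (c + p) = c + shiftPos i m p := by
  unfold shiftPos
  split_ifs <;> omega

/-- `IsInflation h f n i g m` says that the word `h` of length `n + m - 1` compares letters like
the word `f` of length `n` in which the letter at position `i` is replaced by the word `g` of
length `m`. -/
structure IsInflation (h f : ℕ → ℕ) (n i : ℕ) (g : ℕ → ℕ) (m : ℕ) : Prop where
  outer : ∀ p < n, ∀ q < n, p ≠ i → q ≠ i → f p < f q →
    h (shiftPos i m p) < h (shiftPos i m q)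
  inner : ∀ p < m, ∀ q < m, g p < g q → h (i + p) < h (i + q)
  inner_lt : ∀ p < m, ∀ q < n, q ≠ i → f i < f q → h (i + p) < h (shiftPos i m q)
  lt_inner : ∀ p < m, ∀ q < n, q ≠ i → f q < f i → h (shiftPos i m q) < h (i + p)

namespace IsInflation

variable {h f g : ℕ → ℕ} {n m i : ℕ}

theorem take (H : IsInflation h f n i g m) {k : ℕ} (hk : k ≤ n) : IsInflation h f k i g m where
  outer p hp q hq := H.outer p (by omega) q (by omega)
  inner := H.inner
  inner_lt p hp q hq := H.inner_lt p hp q (by omega)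
  lt_inner p hp q hq := H.lt_inner p hp q (by omega)

theorem drop {c : ℕ} (hm : 1 ≤ m) (H : IsInflation h f (c + n) (c + i) g m) :
    IsInflation (fun x => h (c + x)) (fun x => f (c + x)) n i g m where
  outer p hp q hq hpi hqi hpq := by
    simpa only [shiftPos_add _ _ _ _ hm] using
      H.outer (c + p) (by omega) (c + q) (by omega) (by omega) (by omega) hpq
  inner p hp q hq hpq := by
    simpa only [add_assoc] using H.inner p hp q hq hpq
  inner_lt p hp q hq hqi hlt := by
    simpa only [shiftPos_add _ _ _ _ hm, add_assoc] using
      H.inner_lt p hp (c + q) (by omega) (by omega) hlt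
  lt_inner p hp q hq hqi hlt := by
    simpa only [shiftPos_add _ _ _ _ hm, add_assoc] using
      H.lt_inner p hp (c + q) (by omega) (by omega) hlt

/-- A position of the inflated word is a letter of the inner word or a shifted outer letter. -/
theorem pos_cases (hi : i < n) {k : ℕ} (hk : k < n + m - 1) :
    (∃ p < m, k = i + p) ∨ ∃ p < n, p ≠ i ∧ k = shiftPos i m p := by
  by_cases h₁ : k < i
  · exact .inr ⟨k, by omega, by omega, (shiftPos_of_lt h₁).symm⟩
  by_cases h₂ : k < i + m
  · exact .inl ⟨k - i, by omega, by omega⟩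
  · refine .inr ⟨k - m + 1, by omega, by omega, ?_⟩
    rw [shiftPos_of_gt (by omega)]
    omega

theorem lt_shiftPos (H : IsInflation h f n i g m) (hi : i < n) {j : ℕ}
    (hj : j < n) (hji : j ≠ i) (hmax : ∀ k < n, k ≠ j → f k < f j) {k : ℕ}
    (hk : k < n + m - 1) (hkj : k ≠ shiftPos i m j) : h k < h (shiftPos i m j) := by
  rcases pos_cases hi hk with ⟨p, hp, rfl⟩ | ⟨p, hp, hpi, rfl⟩
  · exact H.inner_lt p hp j hj hji (hmax i hi hji.symm)
  · exact H.outer p hp j hj hpi hji (hmax p hp fun e => hkj (e ▸ rfl))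

theorem lt_inner_max (H : IsInflation h f n i g m) (hi : i < n)
    (hmax : ∀ k < n, k ≠ i → f k < f i) {j : ℕ} (hj : j < m)
    (hmax' : ∀ k < m, k ≠ j → g k < g j) {k : ℕ} (hk : k < n + m - 1) (hkj : k ≠ i + j) :
    h k < h (i + j) := by
  rcases pos_cases hi hk with ⟨p, hp, rfl⟩ | ⟨p, hp, hpi, rfl⟩
  · exact H.inner p hp j hj (hmax' p hp fun e => hkj (e ▸ rfl))
  · exact H.lt_inner j hj p hp hpi (hmax p hp hpi)

end IsInflation

theorem IsDecTree.binsert {g : ℕ → ℕ} {m : ℕ} {t : PBT} (hm : 1 ≤ m) (ht : IsDecTree g m t)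
    {s : PBT} : ∀ {h f : ℕ → ℕ} {n i : ℕ}, i < n → IsDecTree f n s → IsInflation h f n i g m →
    IsDecTree h (n + m - 1) (PBT.binsert s (i + 1) t) := by
  induction s with
  | leaf =>
    intro h f n i hi hs _
    simp only [IsDecTree] at hs
    omega
  | node l r ihl ihr =>
    rintro h f n i hi ⟨j, hj, hmax, hl, hr⟩ H
    rw [PBT.binsert.eq_def]
    simp only [hl.size_eq]
    rcases lt_trichotomy i j with hij | rfl | hij
    · rw [if_pos (by omega)]
      have hp := shiftPos_of_gt (m := m) hij
      refine ⟨j + m - 1, by omega, fun k hk hkj => ?_, ihl hij hl (H.take hj.le), ?_⟩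
      · rw [← hp] at hkj ⊢
        exact H.lt_shiftPos hi hj hij.ne' hmax hk hkj
      · rw [show n + m - 1 - 1 - (j + m - 1) = n - 1 - j by omega]
        refine hr.of_lt_imp_lt fun p hp q hq hpq => ?_
        have := H.outer (j + 1 + p) (by omega) (j + 1 + q) (by omega) (by omega) (by omega) hpq
        rw [shiftPos_of_gt (by omega), shiftPos_of_gt (by omega)] at this
        rwa [show j + m - 1 + 1 + p = j + 1 + p + m - 1 by omega,
          show j + m - 1 + 1 + q = j + 1 + q + m - 1 by omega]
    · rw [if_neg (by omega), if_pos rfl]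
      rcases t with _ | ⟨tl, tr⟩
      · simp only [IsDecTree] at ht
        omega
      obtain ⟨k, hk, hmax', htl, htr⟩ := ht
      have hleft : ∀ p < i, ∀ q < m, h p < h (i + q) := fun p hp q hq => by
        simpa only [shiftPos_of_lt hp] using
          H.lt_inner q hq p (by omega) (by omega) (hmax p (by omega) (by omega))
      refine ⟨i + k, by omega, fun a ha hak => H.lt_inner_max hi hmax hk hmax' ha hak,
        IsDecTree.over_of_forall_lt ?_ ?_ fun p hp q hq => hleft p hp q (by omega), ?_⟩
      · refine hl.of_lt_imp_lt fun p hp q hq hpq => ?_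
        simpa only [shiftPos_of_lt hp, shiftPos_of_lt hq] using
          H.outer p (by omega) q (by omega) (by omega) (by omega) hpq
      · exact htl.of_lt_imp_lt fun p hp q hq => H.inner p (by omega) q (by omega)
      · rw [show n + m - 1 - 1 - (i + k) = (m - 1 - k) + (n - 1 - i) by omega]
        have hpos : ∀ q, i + k + 1 + (m - 1 - k + q) = shiftPos i m (i + 1 + q) := fun q => by
          rw [shiftPos_of_gt (by omega)]
          omega
        refine IsDecTree.under_of_forall_lt ?_ ?_ fun p hp q hq => ?_
        · refine htr.of_lt_imp_lt fun p hp q hq hpq => ?_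
          simpa only [add_assoc] using H.inner _ (by omega) _ (by omega) hpq
        · refine hr.of_lt_imp_lt fun p hp q hq hpq => ?_
          rw [hpos, hpos]
          exact H.outer _ (by omega) _ (by omega) (by omega) (by omega) hpq
        · rw [hpos, show i + k + 1 + p = i + (k + 1 + p) by omega]
          exact H.lt_inner (k + 1 + p) (by omega) _ (by omega) (by omega)
            (hmax _ (by omega) (by omega))
    · rw [if_neg (by omega), if_neg (by omega)]
      have hp := shiftPos_of_lt (m := m) hij
      refine ⟨j, by omega, fun k hk hkj => ?_, ?_, ?_⟩
      · rw [← hp] at hkj ⊢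
        exact H.lt_shiftPos hi hj hij.ne hmax hk hkj
      · refine hl.of_lt_imp_lt fun p hp q hq hpq => ?_
        simpa only [shiftPos_of_lt (hp.trans hij), shiftPos_of_lt (hq.trans hij)] using
          H.outer p (by omega) q (by omega) (by omega) (by omega) hpq
      · obtain ⟨i, rfl⟩ : ∃ i', i = j + 1 + i' := ⟨i - (j + 1), by omega⟩
        obtain ⟨n, rfl⟩ : ∃ n', n = j + 1 + n' := ⟨n - (j + 1), by omega⟩
        rw [show j + 1 + n - 1 - j = n by omega] at hr
        rw [show j + 1 + n + m - 1 - 1 - j = n + m - 1 by omega,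
          show j + 1 + i + 1 - (j + 1) = i + 1 by omega]
        exact ihr (by omega) hr (H.drop hm)

theorem pv_lt {N : ℕ} (σ : Equiv.Perm (Fin N)) {j : ℕ} (hj : j < N) : pv σ j < N := by
  simp [pv, hj]

theorem pv_injOn {N : ℕ} (σ : Equiv.Perm (Fin N)) {j k : ℕ} (hj : j < N) (hk : k < N)
    (h : pv σ j = pv σ k) : j = k := by
  simpa [pv, hj, hk, Fin.val_inj] using h

theorem IsLam.isDecTree {n : ℕ} {σ : Equiv.Perm (Fin n)} {t : PBT} (h : IsLam σ t) :
    IsDecTree (pv σ) n t := by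
  induction h with
  | base σ => rfl
  | node σ j hj hmax hl hr _ _ ihl ihr =>
    refine ⟨j, hj, fun k hk hkj => ?_, ihl.of_lt_imp_lt fun p hp q hq hpq => ?_,
      ihr.of_lt_imp_lt fun p hp q hq hpq => ?_⟩
    · have h₁ := pv_lt σ hk
      have h₂ : pv σ k ≠ pv σ j := fun e => hkj (pv_injOn σ hk hj e)
      omega
    · exact (hl ⟨p, hp⟩ ⟨q, hq⟩).1 (by simpa [pv, hp, hq] using hpq)
    · exact (hr ⟨p, hp⟩ ⟨q, hq⟩).1 (by simpa [pv, hp, hq] using hpq)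

theorem BFun_shiftPos {n m : ℕ} (hm : 1 ≤ m) (i : ℕ) (σ : Equiv.Perm (Fin n))
    (τ : Equiv.Perm (Fin m)) {p : ℕ} (hp : p ≠ i) :
    BFun i σ τ (shiftPos i m p) = avv m (pv σ i) (pv σ p) := by
  rcases lt_or_gt_of_ne hp with h | h
  · rw [shiftPos_of_lt h, BFun, if_pos h]
  · rw [shiftPos_of_gt h, BFun, if_neg (by omega), if_neg (by omega),
      show p + m - 1 - m + 1 = p by omega]

theorem BFun_add {n m : ℕ} (i : ℕ) (σ : Equiv.Perm (Fin n)) (τ : Equiv.Perm (Fin m)) {p : ℕ}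
    (hp : p < m) : BFun i σ τ (i + p) = pv τ p + pv σ i := by
  rw [BFun, if_neg (by omega), if_pos (by omega), Nat.add_sub_cancel_left]

theorem isInflation_BFun {n m : ℕ} (hm : 1 ≤ m) (i : ℕ) (σ : Equiv.Perm (Fin n))
    (τ : Equiv.Perm (Fin m)) : IsInflation (BFun i σ τ) (pv σ) n i (pv τ) m where
  outer p _ q _ hpi hqi hpq := by
    rw [BFun_shiftPos hm i σ τ hpi, BFun_shiftPos hm i σ τ hqi, avv, avv]
    split_ifs <;> omega
  inner p hp q hq hpq := by
    rw [BFun_add i σ τ hp, BFun_add i σ τ hq]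
    omega
  inner_lt p hp q _ hqi hlt := by
    have := pv_lt τ hp
    rw [BFun_shiftPos hm i σ τ hqi, BFun_add i σ τ hp, avv]
    split_ifs <;> omega
  lt_inner p hp q _ hqi hlt := by
    rw [BFun_shiftPos hm i σ τ hqi, BFun_add i σ τ hp, avv, if_pos hlt]
    omega

/-- **Lemma.** `λ(B_i(σ,τ)) = B_i(λ(σ), λ(τ))` (the tree-insertion on the right being
taken at the 1-indexed position `i + 1`, since our permutation positions are 0-indexed). -/
theorem lam_B {n m : ℕ} (hn : 1 ≤ n) (hm : 1 ≤ m) (i : ℕ) (hi : i < n)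
    (σ : Equiv.Perm (Fin n)) (τ : Equiv.Perm (Fin m))
    (ρ : Equiv.Perm (Fin (n + m - 1))) (hρ : IsB i σ τ ρ)
    (s t u : PBT) (hs : IsLam σ s) (ht : IsLam τ t) (hu : IsLam ρ u) :
    u = PBT.binsert s (i + 1) t := by
  refine hu.isDecTree.unique
    ((ht.isDecTree.binsert hm hi hs.isDecTree (isInflation_BFun hm i σ τ)).of_lt_imp_lt ?_)
  intro p hp q hq hpq
  rwa [hρ p hp, hρ q hq]
end

section
/- For every n ≥ 1, the element θ_n ∈ ℤS_n (defined by θ_1 = F_{id_1} and θ_n = {θ_{n−1}, F_{id_1}} for n ≥ 2) satisfies θ_n = Σ_{σ ∈ S_n, σ_1 = 1} M_σ, the sum running over all permutations σ ∈ S_n whose first value is 1. -/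
open Equiv

/-- The monomial basis element `M_σ = Σ_{σ ≤ τ} μ(σ,τ) F_τ` of the free `ℤ`-module
`ℤS_N = Perm (Fin N) →₀ ℤ`, for a given Möbius function `mu` of the weak order;
here `F_τ = Finsupp.single τ 1`. -/
noncomputable def Msig {N : ℕ} (mu : Equiv.Perm (Fin N) → Equiv.Perm (Fin N) → ℤ)
    (σ : Equiv.Perm (Fin N)) : Equiv.Perm (Fin N) →₀ ℤ :=
  ∑ τ ∈ Finset.univ.filter (fun τ => wle σ τ), mu σ τ • Finsupp.single τ (1 : ℤ)

/-- The statement that `mu` is the Möbius function of the left weak order in each degree: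
`Σ_{σ ≤ ρ ≤ τ} μ(σ,ρ)` equals `1` if `σ = τ` and `0` if `σ < τ`. -/
def IsMoebius (mu : ∀ N : ℕ, Equiv.Perm (Fin N) → Equiv.Perm (Fin N) → ℤ) : Prop :=
  ∀ (N : ℕ) (σ τ : Equiv.Perm (Fin N)), wle σ τ →
    (∑ ρ ∈ Finset.univ.filter (fun ρ => wle σ ρ ∧ wle ρ τ), mu N σ ρ)
      = if σ = τ then 1 else 0

/-- The permutation `σ/τ ∈ S_{n+m}`: `(σ_1,…,σ_n, τ_1+n,…,τ_m+n)` in one-line notation. -/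
def slashP {n m : ℕ} (σ : Equiv.Perm (Fin n)) (τ : Equiv.Perm (Fin m)) :
    Equiv.Perm (Fin (n + m)) :=
  finSumFinEquiv.permCongr (Equiv.sumCongr σ τ)

/-- The permutation `Z_{n,m} = (m+1, m+2, …, m+n, 1, 2, …, m) ∈ S_{n+m}`. -/
def zperm (n m : ℕ) : Equiv.Perm (Fin (n + m)) :=
  finSumFinEquiv.symm.trans ((Equiv.sumComm (Fin n) (Fin m)).trans
    (finSumFinEquiv.trans (finCongr (Nat.add_comm m n))))

/-- The permutation `σ\τ ∈ S_{n+m}`: `(σ_1+m,…,σ_n+m, τ_1,…,τ_m)` in one-line notation.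
It equals `Z_{n,m} ∘ (σ/τ)`. -/
def backslashP {n m : ℕ} (σ : Equiv.Perm (Fin n)) (τ : Equiv.Perm (Fin m)) :
    Equiv.Perm (Fin (n + m)) :=
  zperm n m * slashP σ τ

/-- The twisted Lie bracket `{·,·} : ℤS_n × ℤS_m → ℤS_{n+m}`, the bilinear map determined
by `{F_σ, F_τ} = F_{σ/τ} - F_{σ\τ}`. -/
noncomputable def brk {n m : ℕ} (x : Equiv.Perm (Fin n) →₀ ℤ) (y : Equiv.Perm (Fin m) →₀ ℤ) :
    Equiv.Perm (Fin (n + m)) →₀ ℤ :=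
  x.sum fun σ c => y.sum fun τ d =>
    (c * d) • (Finsupp.single (slashP σ τ) (1 : ℤ) - Finsupp.single (backslashP σ τ) (1 : ℤ))

/-- Dynkin's element `θ_{k+1} ∈ ℤS_{k+1}`:
`θ_1 = F_{id}` and `θ_{n} = {θ_{n-1}, F_{id}}` (left-nested brackets). -/
noncomputable def theta : (k : ℕ) → (Equiv.Perm (Fin (k + 1)) →₀ ℤ)
  | 0 => Finsupp.single 1 1
  | (k + 1) => brk (theta k) (Finsupp.single (1 : Equiv.Perm (Fin 1)) (1 : ℤ))

section InversionSums

/-- `f` inverts every pair of positions inverted by `σ`. -/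
def InvertsAll {n : ℕ} (σ : Equiv.Perm (Fin n)) (f : Fin n → ℕ) : Prop :=
  ∀ p q : Fin n, p < q → σ q < σ p → f q < f p

open Classical in
/-- The linear form `F_σ ↦ 1` if `Inv σ ⊆ Inv f`, and `F_σ ↦ 0` otherwise. -/
noncomputable def invForm {n : ℕ} (f : Fin n → ℕ) : (Equiv.Perm (Fin n) →₀ ℤ) →ₗ[ℤ] ℤ :=
  Finsupp.linearCombination ℤ fun σ => if InvertsAll σ f then (1 : ℤ) else 0

theorem slashP_castSucc {n : ℕ} (σ : Equiv.Perm (Fin n)) (i : Fin n) :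
    slashP σ (1 : Equiv.Perm (Fin 1)) i.castSucc = (σ i).castSucc := by
  change slashP σ (1 : Equiv.Perm (Fin 1)) (Fin.castAdd 1 i) = Fin.castAdd 1 (σ i)
  simp [slashP, Equiv.permCongr_apply]

theorem slashP_last {n : ℕ} (σ : Equiv.Perm (Fin n)) :
    slashP σ (1 : Equiv.Perm (Fin 1)) (Fin.last n) = Fin.last n := by
  change slashP σ (1 : Equiv.Perm (Fin 1)) (Fin.natAdd n 0) = Fin.natAdd n 0
  simp only [slashP, Equiv.permCongr_apply, finSumFinEquiv_symm_apply_natAdd]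
  simp

theorem backslashP_castSucc {n : ℕ} (σ : Equiv.Perm (Fin n)) (i : Fin n) :
    backslashP σ (1 : Equiv.Perm (Fin 1)) i.castSucc = (σ i).succ := by
  rw [backslashP, Equiv.Perm.mul_apply, slashP_castSucc]
  change zperm n 1 (Fin.castAdd 1 (σ i)) = _
  ext
  simp only [zperm, Equiv.trans_apply, finSumFinEquiv_symm_apply_castAdd]
  simp [add_comm]

theorem backslashP_last {n : ℕ} (σ : Equiv.Perm (Fin n)) :
    backslashP σ (1 : Equiv.Perm (Fin 1)) (Fin.last n) = 0 := by
  rw [backslashP, Equiv.Perm.mul_apply, slashP_last]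
  change zperm n 1 (Fin.natAdd n 0) = _
  ext
  simp only [zperm, Equiv.trans_apply, finSumFinEquiv_symm_apply_natAdd]
  simp

theorem invertsAll_slashP_iff {n : ℕ} (σ : Equiv.Perm (Fin n)) (f : Fin (n + 1) → ℕ) :
    InvertsAll (slashP σ (1 : Equiv.Perm (Fin 1))) f ↔ InvertsAll σ (f ∘ Fin.castSucc) := by
  simp only [InvertsAll, Fin.forall_fin_succ', slashP_castSucc, slashP_last]
  simp [Fin.castSucc_lt_last, (Fin.castSucc_lt_last _).not_gt]

theorem invertsAll_backslashP_iff {n : ℕ} (σ : Equiv.Perm (Fin n)) (f : Fin (n + 1) → ℕ) :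
    InvertsAll (backslashP σ (1 : Equiv.Perm (Fin 1))) f ↔
      InvertsAll σ (f ∘ Fin.castSucc) ∧ ∀ i : Fin n, f (Fin.last n) < f i.castSucc := by
  simp only [InvertsAll, Fin.forall_fin_succ', backslashP_castSucc, backslashP_last]
  simp [Fin.castSucc_lt_last, (Fin.castSucc_lt_last _).not_gt, forall_and]

open Classical in
theorem invForm_brk_single_one {n : ℕ} (x : Equiv.Perm (Fin n) →₀ ℤ) (f : Fin (n + 1) → ℕ) :
    invForm f (brk x (Finsupp.single (1 : Equiv.Perm (Fin 1)) (1 : ℤ))) =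
      invForm (f ∘ Fin.castSucc) x *
        if ∀ i : Fin n, f (Fin.last n) < f i.castSucc then 0 else 1 := by
  simp only [brk, Finsupp.sum_single_index, mul_zero, zero_smul, mul_one,
    map_finsuppSum, map_smul, map_sub, invForm, Finsupp.linearCombination_single, one_smul,
    invertsAll_slashP_iff, invertsAll_backslashP_iff]
  rw [Finsupp.linearCombination_apply, Finsupp.sum_mul]
  refine Finsupp.sum_congr fun σ _ => ?_
  by_cases h₁ : InvertsAll σ (f ∘ Fin.castSucc) <;>
    by_cases h₂ : ∀ i : Fin n, f (Fin.last n) < f i.castSucc <;> simp [h₁, h₂]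

open Classical in
theorem invForm_theta (k : ℕ) (f : Fin (k + 1) → ℕ) (hf : Function.Injective f) :
    invForm f (theta k) = if ∀ i, f 0 ≤ f i then 1 else 0 := by
  induction k with
  | zero =>
    have h : InvertsAll (1 : Equiv.Perm (Fin 1)) f := fun p q hpq => by omega
    have h' : ∀ i, f 0 ≤ f i := fun i => by rw [Fin.fin_one_eq_zero i]
    simp [theta, invForm, h, h']
  | succ k ih =>
    rw [theta, invForm_brk_single_one, ih _ (hf.comp (Fin.castSucc_injective _))]
    have hne : f (Fin.last (k + 1)) ≠ f 0 := fun h => by simpa using hf h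
    by_cases h₁ : ∀ i, (f ∘ Fin.castSucc) 0 ≤ (f ∘ Fin.castSucc) i
    · have h₂ : (∀ i : Fin (k + 1), f (Fin.last (k + 1)) < f i.castSucc) ↔
          ¬ ∀ i, f 0 ≤ f i := by
        rw [Fin.forall_fin_succ' (P := fun i => f 0 ≤ f i)]
        constructor
        · intro h h'
          have := h 0
          rw [Fin.castSucc_zero] at this
          omega
        · intro h i
          have : f 0 ≤ f i.castSucc := h₁ i
          have : ¬ f 0 ≤ f (Fin.last (k + 1)) := fun h' => h ⟨h₁, h'⟩
          omega
      rw [if_pos h₁, one_mul]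
      by_cases h₃ : ∀ i, f 0 ≤ f i
      · rw [if_neg fun h => h₂.mp h h₃, if_pos h₃]
      · rw [if_pos (h₂.mpr h₃), if_neg h₃]
    · have h₂ : ¬ ∀ i, f 0 ≤ f i := fun h => h₁ fun i => h _
      rw [if_neg h₁, if_neg h₂, zero_mul]

end InversionSums

section Moebius

theorem wle_refl {N : ℕ} (σ : Equiv.Perm (Fin N)) : wle σ σ := fun _ _ _ h => h

theorem wle_trans {N : ℕ} {σ τ ρ : Equiv.Perm (Fin N)} (h₁ : wle σ τ) (h₂ : wle τ ρ) :
    wle σ ρ := fun p q hpq h => h₂ p q hpq (h₁ p q hpq h)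

theorem invertsAll_val_iff {N : ℕ} (σ τ : Equiv.Perm (Fin N)) :
    InvertsAll σ (fun i => (τ i : ℕ)) ↔ wle σ τ := Iff.rfl

/-- The zeta matrix of the weak order. -/
def zetaMatrix (N : ℕ) : Matrix (Equiv.Perm (Fin N)) (Equiv.Perm (Fin N)) ℤ :=
  Matrix.of fun σ τ => if wle σ τ then 1 else 0

/-- The matrix of `mu`, restricted to comparable pairs. -/
def moebiusMatrix {N : ℕ} (mu : Equiv.Perm (Fin N) → Equiv.Perm (Fin N) → ℤ) :
    Matrix (Equiv.Perm (Fin N)) (Equiv.Perm (Fin N)) ℤ :=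
  Matrix.of fun σ τ => if wle σ τ then mu σ τ else 0

theorem moebiusMatrix_mul_zetaMatrix
    {mu : ∀ N : ℕ, Equiv.Perm (Fin N) → Equiv.Perm (Fin N) → ℤ} (hmu : IsMoebius mu) (N : ℕ) :
    moebiusMatrix (mu N) * zetaMatrix N = 1 := by
  ext σ τ
  have h : (moebiusMatrix (mu N) * zetaMatrix N) σ τ =
      ∑ ρ ∈ Finset.univ.filter (fun ρ => wle σ ρ ∧ wle ρ τ), mu N σ ρ := by
    rw [Matrix.mul_apply, Finset.sum_filter]
    refine Finset.sum_congr rfl fun ρ _ => ?_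
    by_cases h₁ : wle σ ρ <;> by_cases h₂ : wle ρ τ <;>
      simp [moebiusMatrix, zetaMatrix, h₁, h₂]
  rw [h, Matrix.one_apply]
  by_cases hle : wle σ τ
  · exact hmu N σ τ hle
  · rw [if_neg (by rintro rfl; exact hle (wle_refl σ))]
    refine Finset.sum_eq_zero fun ρ hρ => ?_
    rw [Finset.mem_filter] at hρ
    exact absurd (wle_trans hρ.2.1 hρ.2.2) hle

theorem Msig_apply {N : ℕ} (mu : Equiv.Perm (Fin N) → Equiv.Perm (Fin N) → ℤ)
    (σ τ : Equiv.Perm (Fin N)) : Msig mu σ τ = moebiusMatrix mu σ τ := by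
  simp [Msig, moebiusMatrix, Finsupp.finsetSum_apply, Finsupp.single_apply]

theorem vecMul_zetaMatrix {N : ℕ} (x : Equiv.Perm (Fin N) →₀ ℤ) (τ : Equiv.Perm (Fin N)) :
    Matrix.vecMul x (zetaMatrix N) τ = invForm (fun i => (τ i : ℕ)) x := by
  classical
  rw [invForm, Finsupp.linearCombination_apply, Finsupp.sum_fintype _ _ (by simp)]
  simp [Matrix.vecMul, dotProduct, zetaMatrix, invertsAll_val_iff]

theorem pv_zero_eq_zero_iff {k : ℕ} (σ : Equiv.Perm (Fin (k + 1))) :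
    pv σ 0 = 0 ↔ ∀ i, (σ 0 : ℕ) ≤ σ i := by
  have h : pv σ 0 = (σ 0 : ℕ) := by simp [pv]
  rw [h]
  refine ⟨fun h i => by omega, fun h => ?_⟩
  simpa using h (σ.symm 0)

end Moebius

/-- **Theorem (Dynkin's idempotent in the monomial basis).**
For every `n ≥ 1` (written `n = k+1`), `θ_n = Σ_{σ ∈ S_n, σ(1)=1} M_σ`
(0-indexed: `σ(0) = 0`). -/
theorem theta_eq_sum_M
    (mu : ∀ N : ℕ, Equiv.Perm (Fin N) → Equiv.Perm (Fin N) → ℤ) (hmu : IsMoebius mu) :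
    ∀ k : ℕ, theta k
      = ∑ σ ∈ Finset.univ.filter (fun σ : Equiv.Perm (Fin (k + 1)) => pv σ 0 = 0),
          Msig (mu (k + 1)) σ := by
  intro k
  have hζ : zetaMatrix (k + 1) * moebiusMatrix (mu (k + 1)) = 1 :=
    mul_eq_one_comm.mp (moebiusMatrix_mul_zetaMatrix hmu (k + 1))
  have hθ : Matrix.vecMul (theta k) (zetaMatrix (k + 1)) =
      fun σ => if pv σ 0 = 0 then 1 else 0 := by
    funext σ
    rw [vecMul_zetaMatrix, invForm_theta k (fun i => (σ i : ℕ)) (Fin.val_injective.comp σ.injective)]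
    simp only [pv_zero_eq_zero_iff]
  ext τ
  calc theta k τ = Matrix.vecMul (Matrix.vecMul (theta k) (zetaMatrix (k + 1)))
        (moebiusMatrix (mu (k + 1))) τ := by
        rw [Matrix.vecMul_vecMul, hζ, Matrix.vecMul_one]
    _ = _ := by
        rw [hθ, Finsupp.finsetSum_apply, Finset.sum_filter]
        simp [Matrix.vecMul, dotProduct, Msig_apply]
end
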